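/- A finite graph G has treewidth at most k if and only if G admits an elimination ordering of width at most k. -/

import Mathlib

/-! Elimination orderings, fill-in graphs, and dependency treewidth. -/

/-- The fill-in graph of `G` w.r.t. the elimination ordering `e : Fin n ≃ V`
(`e 0` is eliminated first): the unique minimal supergraph `H` of `G` such that
whenever `k < i < j` and both `e i` and `e j` are neighbors of `e k` in `H`,
then `e i` and `e j` are adjacent in `H`. -/
def fillIn {V : Type} (G : SimpleGraph V) {n : ℕ} (e : Fin n ≃ V) : SimpleGraph V :=
  sInf {H : SimpleGraph V | G ≤ H ∧ ∀ k i j : Fin n, k < i → i < j →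
    H.Adj (e k) (e i) → H.Adj (e k) (e j) → H.Adj (e i) (e j)}

/-- The width of the elimination ordering `e` of `G`: the maximum, over all vertices `v`,
of the number of neighbors of `v` in the fill-in graph that occur later than `v`. -/
noncomputable def elimWidth {V : Type} (G : SimpleGraph V) {n : ℕ} (e : Fin n ≃ V) : ℕ :=
  Finset.univ.sup fun k : Fin n =>
    {i : Fin n | k < i ∧ (fillIn G e).Adj (e k) (e i)}.ncard

/-- `e` is a `P`-elimination ordering of `G` for the poset (relation) `r`:
it is a linear extension of the reverse of `r`, i.e. whenever `u ≤ v` and `u ≠ v`,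
then `v` occurs before `u` in the ordering. -/
def IsDepElim {V : Type} (G : SimpleGraph V) (r : V → V → Prop) {n : ℕ}
    (e : Fin n ≃ V) : Prop :=
  ∀ u v : V, r u v → u ≠ v → e.symm v < e.symm u

/-- The dependency treewidth of `G` w.r.t. `r`: the minimum width of a
`P`-elimination ordering of `G`. -/
noncomputable def depTreewidth {V : Type} [Fintype V] (G : SimpleGraph V)
    (r : V → V → Prop) : ℕ :=
  sInf {w : ℕ | ∃ e : Fin (Fintype.card V) ≃ V, IsDepElim G r e ∧ elimWidth G e = w}

/-! Rooted tree decompositions. -/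

/-- `t` is an ancestor of `s` in the tree `T` rooted at `root`
(every walk from the root to `s` passes through `t`; in a tree this says that `t`
lies on the unique path from the root to `s`).  In particular every node is an
ancestor of itself. -/
def ancIn {ι : Type} (T : SimpleGraph ι) (root t s : ι) : Prop :=
  ∀ w : T.Walk root s, t ∈ w.support

/-- `t` is a child of `p` in the tree `T` rooted at `root`. -/
def childIn {ι : Type} (T : SimpleGraph ι) (root p t : ι) : Prop :=
  T.Adj p t ∧ ancIn T root p t

/-- A (rooted) tree decomposition of the graph `G` with nodes indexed by `ι`:
(T1) the bags cover `V(G)`, (T2) every edge of `G` is contained in some bag, and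
(T3) for each vertex the nodes whose bags contain it induce a connected subtree. -/
structure TreeDecomp {V : Type} (G : SimpleGraph V) (ι : Type) [Fintype ι] : Type where
  T : SimpleGraph ι
  isTree : T.IsTree
  root : ι
  bag : ι → Finset V
  cover : ∀ v : V, ∃ t : ι, v ∈ bag t
  coverEdge : ∀ u v : V, G.Adj u v → ∃ t : ι, u ∈ bag t ∧ v ∈ bag t
  connBag : ∀ (v : V) (t₁ t₂ : ι), v ∈ bag t₁ → v ∈ bag t₂ →
    ∃ w : T.Walk t₁ t₂, ∀ s ∈ w.support, v ∈ bag s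

namespace TreeDecomp

variable {V : Type} {G : SimpleGraph V} {ι : Type} [Fintype ι]

/-- The width of a tree decomposition: maximum bag size minus one. -/
def width (D : TreeDecomp G ι) : ℕ :=
  (Finset.univ.sup fun t : ι => (D.bag t).card) - 1

/-- `t` is the `≤_T`-minimal (closest to the root) node whose bag contains `v`. -/
def IsTop (D : TreeDecomp G ι) (v : V) (t : ι) : Prop :=
  v ∈ D.bag t ∧ ∀ s : ι, v ∈ D.bag s → ancIn D.T D.root t s

/-- Property (T4): the decomposition is compatible with the relation `r`; whenever
`t_u` is a proper ancestor of `t_v`, it does not hold that `v ≤ u`. -/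
def Dep (D : TreeDecomp G ι) (r : V → V → Prop) : Prop :=
  ∀ (u v : V) (tu tv : ι), D.IsTop u tu → D.IsTop v tv →
    ancIn D.T D.root tu tv → tu ≠ tv → ¬ r v u

/-- The union of the bags of all nodes in the subtree rooted at `c`. -/
def subtreeBags (D : TreeDecomp G ι) (c : ι) : Set V :=
  {v : V | ∃ s : ι, ancIn D.T D.root c s ∧ v ∈ D.bag s}

end TreeDecomp

section FillIn

variable {V : Type} {G : SimpleGraph V} {n : ℕ} {e : Fin n ≃ V}

theorem fillIn_le {H : SimpleGraph V} (hG : G ≤ H)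
    (hH : ∀ k i j : Fin n, k < i → i < j →
      H.Adj (e k) (e i) → H.Adj (e k) (e j) → H.Adj (e i) (e j)) :
    fillIn G e ≤ H :=
  sInf_le ⟨hG, hH⟩

theorem le_fillIn : G ≤ fillIn G e :=
  le_sInf fun _ hH => hH.1

theorem fillIn_adj_of_lt {k i j : Fin n} (hki : k < i) (hij : i < j)
    (hi : (fillIn G e).Adj (e k) (e i)) (hj : (fillIn G e).Adj (e k) (e j)) :
    (fillIn G e).Adj (e i) (e j) := by
  rw [fillIn, SimpleGraph.sInf_adj] at *
  exact ⟨fun H hH => hH.2 k i j hki hij (hi.1 H hH) (hj.1 H hH),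
    fun h => hij.ne (e.injective h)⟩

end FillIn

namespace SimpleGraph

/-- A walk inside `S` starting at a vertex of `S` closest to `r` continues the path from `r`:
in a tree, every vertex of the path from `r` to `s ∈ S` that is at least as far from `r` as the
vertex `t` of `S` closest to `r` lies in `S`, and `t` lies on that path. -/
theorem IsTree.mem_of_mem_support_of_dist_le {ι : Type*} {T : SimpleGraph ι} (hT : T.IsTree)
    {S : Set ι} {r t s : ι} (ht : t ∈ S) (hmin : ∀ x ∈ S, T.dist r t ≤ T.dist r x)
    (w : T.Walk t s) (hw : ∀ x ∈ w.support, x ∈ S) {p : T.Walk r s} (hp : p.IsPath) :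
    t ∈ p.support ∧ ∀ x ∈ p.support, T.dist r t ≤ T.dist r x → x ∈ S := by
  classical
  obtain ⟨q, hq, hql⟩ := hT.connected.exists_path_of_dist r t
  have hqS : ∀ x ∈ q.support, T.dist r t ≤ T.dist r x → x = t := by
    intro x hx hle
    by_contra hne
    have h1 := Walk.length_takeUntil_lt_length hx hne
    have h2 := dist_le (q.takeUntil x hx)
    omega
  have hbS : ∀ x ∈ w.bypass.support, x ∈ S := fun x hx =>
    hw x (w.support_bypass_subset_support hx)
  have hb := w.bypass_isPath
  have happ : (q.append w.bypass).IsPath := by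
    rw [Walk.isPath_def, Walk.support_append, List.nodup_append]
    refine ⟨hq.support_nodup, hb.support_nodup.tail, ?_⟩
    rintro x hxq _ hxb rfl
    obtain rfl := hqS x hxq (hmin x (hbS x (List.mem_of_mem_tail hxb)))
    have := hb.support_nodup
    rw [← Walk.cons_tail_support, List.nodup_cons] at this
    exact this.1 hxb
  obtain rfl : p = q.append w.bypass :=
    congrArg Subtype.val ((hT.isAcyclic.subsingleton_path r s).elim ⟨p, hp⟩ ⟨_, happ⟩)
  simp only [Walk.mem_support_append_iff]
  refine ⟨Or.inl q.end_mem_support, ?_⟩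
  rintro x (hx | hx) hle
  · exact hqS x hx hle ▸ ht
  · exact hbS x hx

/-- The graph joining each `i` except the last to a larger element `p i` is a tree. -/
theorem isTree_fromRel_of_lt {n : ℕ} (p : Fin (n + 1) → Fin (n + 1))
    (hp : ∀ i, i ≠ Fin.last n → i < p i) :
    (fromRel fun i j => i ≠ Fin.last n ∧ p i = j).IsTree := by
  classical
  set T := fromRel fun i j => i ≠ Fin.last n ∧ p i = j with hTdef
  have hreach : ∀ i, T.Reachable i (Fin.last n) := by
    intro i
    induction i using WellFoundedGT.induction with
    | ind i ih =>
      by_cases hi : i = Fin.last n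
      · rw [hi]
      · have hadj : T.Adj i (p i) := by
          rw [hTdef, fromRel_adj]
          exact ⟨(hp i hi).ne, Or.inl ⟨hi, rfl⟩⟩
        exact hadj.reachable.trans (ih _ (hp i hi))
  have hconn : T.Connected :=
    { preconnected := fun i j => (hreach i).trans (hreach j).symm
      nonempty := inferInstance }
  rw [isTree_iff_connected_and_card]
  refine ⟨hconn, le_antisymm ?_ hconn.card_vert_le_card_edgeSet_add_one⟩
  have hsub : T.edgeSet ⊆ (fun i => s(i, p i)) '' {i | i ≠ Fin.last n} := by
    intro x
    induction x with
    | _ a b =>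
      rw [mem_edgeSet, hTdef, fromRel_adj]
      rintro ⟨-, ⟨ha, rfl⟩ | ⟨hb, rfl⟩⟩
      · exact ⟨a, ha, rfl⟩
      · exact ⟨b, hb, Sym2.eq_swap⟩
  have hcard : T.edgeSet.ncard ≤ n := by
    refine (Set.ncard_le_ncard hsub (Set.toFinite _)).trans
      ((Set.ncard_image_le (Set.toFinite _)).trans ?_)
    have h := Set.ncard_compl ({Fin.last n} : Set (Fin (n + 1))) (Set.toFinite _)
    have h' : {i | i ≠ Fin.last n} = ({Fin.last n} : Set (Fin (n + 1)))ᶜ := rfl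
    rw [h', h]
    simp
  rw [Nat.card_coe_set_eq, Nat.card_fin]
  omega

end SimpleGraph

/-- There is an enumeration of `V` along which `f` is weakly decreasing. -/
theorem exists_equiv_antitone {V : Type*} [Fintype V] (f : V → ℕ) :
    ∃ e : Fin (Fintype.card V) ≃ V, Antitone (f ∘ e) := by
  let e₀ := (Fintype.equivFin V).symm
  exact ⟨(Tuple.sort (OrderDual.toDual ∘ f ∘ e₀)).trans e₀,
    Tuple.monotone_sort (OrderDual.toDual ∘ f ∘ e₀)⟩

namespace TreeDecomp

variable {V : Type} {G : SimpleGraph V} {ι : Type} [Fintype ι]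

theorem card_bag_le (D : TreeDecomp G ι) (t : ι) : (D.bag t).card ≤ D.width + 1 := by
  have h := Finset.le_sup (f := fun t => (D.bag t).card) (Finset.mem_univ t)
  simp only [width]
  omega

/-- If `t` is a node closest to the root among those whose bag contains `v`, and `u` occurs in
some bag at most as far from the root as `t`, then `u` is in the bag of `t` as soon as `u` and `v`
share a bag. -/
theorem mem_bag_of_dist_le (D : TreeDecomp G ι) {top : V → ι}
    (htop : ∀ v, v ∈ D.bag (top v))
    (hmin : ∀ v s, v ∈ D.bag s → D.T.dist D.root (top v) ≤ D.T.dist D.root s)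
    {u v : V} (huv : D.T.dist D.root (top u) ≤ D.T.dist D.root (top v))
    {s : ι} (hu : u ∈ D.bag s) (hv : v ∈ D.bag s) : u ∈ D.bag (top v) := by
  obtain ⟨p, hp, -⟩ := D.isTree.connected.exists_path_of_dist D.root s
  obtain ⟨wu, hwu⟩ := D.connBag u _ _ (htop u) hu
  obtain ⟨wv, hwv⟩ := D.connBag v _ _ (htop v) hv
  have h1 := D.isTree.mem_of_mem_support_of_dist_le (S := {x | u ∈ D.bag x})
    (htop u) (hmin u) wu hwu hp
  have h2 := D.isTree.mem_of_mem_support_of_dist_le (S := {x | v ∈ D.bag x})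
    (htop v) (hmin v) wv hwv hp
  exact h1.2 _ h2.1 huv

theorem exists_elimWidth_le [Fintype V] (D : TreeDecomp G ι) :
    ∃ e : Fin (Fintype.card V) ≃ V, elimWidth G e ≤ D.width := by
  classical
  have hex : ∀ v, ∃ t, v ∈ D.bag t ∧ ∀ s, v ∈ D.bag s →
      D.T.dist D.root t ≤ D.T.dist D.root s := by
    intro v
    obtain ⟨t, ht, hmin⟩ := Set.exists_min_image {t | v ∈ D.bag t} (D.T.dist D.root)
      (Set.toFinite _) (D.cover v)
    exact ⟨t, ht, hmin⟩
  choose top htop hmin using hex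
  obtain ⟨e, he⟩ := exists_equiv_antitone fun v => D.T.dist D.root (top v)
  refine ⟨e, Finset.sup_le fun k _ => ?_⟩
  let H : SimpleGraph V := SimpleGraph.fromRel fun u v => ∃ s, u ∈ D.bag s ∧ v ∈ D.bag s
  have hH : ∀ {u v}, H.Adj u v ↔ u ≠ v ∧ ∃ s, u ∈ D.bag s ∧ v ∈ D.bag s := by
    intro u v
    simp only [H, SimpleGraph.fromRel_adj, and_comm (a := v ∈ D.bag _), or_self]
  have hlater : ∀ {k i}, k < i → H.Adj (e k) (e i) → e i ∈ D.bag (top (e k)) := by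
    intro k i hki hadj
    obtain ⟨-, s, hk, hi⟩ := hH.1 hadj
    exact D.mem_bag_of_dist_le htop hmin (he hki.le) hi hk
  have hle : fillIn G e ≤ H := by
    refine fillIn_le (fun u v huv => hH.2 ⟨huv.ne, D.coverEdge u v huv⟩) ?_
    intro k i j hki hij hi hj
    exact hH.2 ⟨fun h => hij.ne (e.injective h), _, hlater hki hi, hlater (hki.trans hij) hj⟩
  have hsub : e '' {i | k < i ∧ (fillIn G e).Adj (e k) (e i)} ⊆
      ((D.bag (top (e k))).erase (e k) : Finset V) := by
    rintro _ ⟨i, ⟨hki, hadj⟩, rfl⟩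
    rw [Finset.mem_coe, Finset.mem_erase]
    exact ⟨hadj.ne', hlater hki (hle hadj)⟩
  have hcard := Set.ncard_le_ncard hsub (Finset.finite_toSet _)
  rw [Set.ncard_image_of_injective _ e.injective, Set.ncard_coe_finset,
    Finset.card_erase_of_mem (htop _)] at hcard
  have := D.card_bag_le (top (e k))
  omega

/-- The decomposition of the graph without vertices into a single empty bag. -/
def ofIsEmpty [IsEmpty V] (G : SimpleGraph V) : TreeDecomp G (Fin 1) where
  T := ⊥
  isTree := SimpleGraph.IsTree.of_subsingleton
  root := 0
  bag _ := ∅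
  cover v := isEmptyElim v
  coverEdge v := isEmptyElim v
  connBag v := isEmptyElim v

theorem exists_width_le_elimWidth {n : ℕ} (e : Fin n ≃ V) :
    ∃ (m : ℕ) (D : TreeDecomp G (Fin m)), D.width ≤ elimWidth G e := by
  classical
  obtain _ | n := n
  · have := e.symm.isEmpty
    exact ⟨1, ofIsEmpty G, by simp [width, ofIsEmpty]⟩
  let R : Fin (n + 1) → Fin (n + 1) → Prop := fun i j => i < j ∧ (fillIn G e).Adj (e i) (e j)
  have hpar : ∀ i, ∃ p, i ≠ Fin.last n → i < p ∧ ∀ j, R i j → R i p ∧ p ≤ j := by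
    intro i
    by_cases h : ∃ j, R i j
    · obtain ⟨p, hp, hmin⟩ := Set.exists_min_image {j | R i j} id (Set.toFinite _) h
      exact ⟨p, fun _ => ⟨hp.1, fun j hj => ⟨hp, hmin j hj⟩⟩⟩
    · exact ⟨Fin.last n, fun hi => ⟨Fin.lt_last_iff_ne_last.2 hi, fun j hj => (h ⟨j, hj⟩).elim⟩⟩
  choose p hp using hpar
  let T : SimpleGraph (Fin (n + 1)) := .fromRel fun i j => i ≠ Fin.last n ∧ p i = j
  let bag : Fin (n + 1) → Finset V := fun k =>
    (Finset.univ.filter fun i => k = i ∨ R k i).map e.toEmbedding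
  have hbag : ∀ {k i}, e i ∈ bag k ↔ k = i ∨ R k i := by simp [bag]
  have hwalk : ∀ i k, k = i ∨ R k i → ∃ w : T.Walk k i, ∀ s ∈ w.support, e i ∈ bag s := by
    intro i k
    induction k using WellFoundedGT.induction with
    | ind k ih =>
      rintro (rfl | hki)
      · exact ⟨.nil, by simp [hbag]⟩
      · have hk : k ≠ Fin.last n := fun h => (h ▸ hki.1).not_ge (Fin.le_last i)
        obtain ⟨hkp, hpm⟩ := hp k hk
        obtain ⟨hRp, hpi⟩ := hpm i hki
        have hmem : p k = i ∨ R (p k) i := hpi.eq_or_lt.imp_right fun hlt =>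
          ⟨hlt, fillIn_adj_of_lt hkp hlt hRp.2 hki.2⟩
        obtain ⟨w, hw⟩ := ih (p k) hkp hmem
        have hadj : T.Adj k (p k) :=
          (SimpleGraph.fromRel_adj _ _ _).2 ⟨hkp.ne, Or.inl ⟨hk, rfl⟩⟩
        refine ⟨.cons hadj w, ?_⟩
        rw [SimpleGraph.Walk.support_cons]
        rintro s (_ | ⟨_, hs⟩)
        · exact hbag.2 (Or.inr hki)
        · exact hw s hs
  refine ⟨n + 1, ⟨T, SimpleGraph.isTree_fromRel_of_lt p fun i hi => (hp i hi).1, Fin.last n, bag,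
    ?_, ?_, ?_⟩, ?_⟩
  · intro v
    obtain ⟨i, rfl⟩ := e.surjective v
    exact ⟨i, hbag.2 (Or.inl rfl)⟩
  · intro u v huv
    obtain ⟨i, rfl⟩ := e.surjective u
    obtain ⟨j, rfl⟩ := e.surjective v
    have hadj : (fillIn G e).Adj (e i) (e j) := le_fillIn huv
    obtain h | rfl | h := lt_trichotomy i j
    · exact ⟨i, hbag.2 (Or.inl rfl), hbag.2 (Or.inr ⟨h, hadj⟩)⟩
    · exact (huv.ne rfl).elim
    · exact ⟨j, hbag.2 (Or.inr ⟨h, hadj.symm⟩), hbag.2 (Or.inl rfl)⟩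
  · intro v t₁ t₂ h₁ h₂
    obtain ⟨i, rfl⟩ := e.surjective v
    obtain ⟨w₁, hw₁⟩ := hwalk i t₁ (hbag.1 h₁)
    obtain ⟨w₂, hw₂⟩ := hwalk i t₂ (hbag.1 h₂)
    refine ⟨w₁.append w₂.reverse, fun s hs => ?_⟩
    rw [SimpleGraph.Walk.mem_support_append_iff, SimpleGraph.Walk.support_reverse,
      List.mem_reverse] at hs
    exact hs.elim (hw₁ s) (hw₂ s)
  · rw [width, Nat.sub_le_iff_le_add]
    refine Finset.sup_le fun k _ => ?_
    have hk : {i | R k i}.ncard ≤ elimWidth G e :=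
      Finset.le_sup (f := fun k : Fin (n + 1) =>
        {i | k < i ∧ (fillIn G e).Adj (e k) (e i)}.ncard) (Finset.mem_univ k)
    have hins : (Finset.univ.filter fun i => k = i ∨ R k i) =
        insert k (Finset.univ.filter (R k)) := by
      ext i
      simp [eq_comm]
    have hR : {i | R k i}.ncard = (Finset.univ.filter (R k)).card := by
      rw [← Set.ncard_coe_finset]
      simp
    simp only [bag, Finset.card_map, hins]
    exact (Finset.card_insert_le _ _).trans (by omega)

end TreeDecomp

/-- A finite graph `G` has treewidth at most `k` (i.e. admits a tree
decomposition of width at most `k`) if and only if it admits an elimination ordering of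
width at most `k`. -/
theorem treewidth_le_iff_elimOrder {V : Type} [Fintype V] [DecidableEq V]
    (G : SimpleGraph V) (k : ℕ) :
    (∃ (n : ℕ) (D : TreeDecomp G (Fin n)), D.width ≤ k) ↔
    (∃ e : Fin (Fintype.card V) ≃ V, elimWidth G e ≤ k) := by
  constructor
  · rintro ⟨n, D, hD⟩
    obtain ⟨e, he⟩ := D.exists_elimWidth_le
    exact ⟨e, he.trans hD⟩
  · rintro ⟨e, he⟩
    obtain ⟨n, D, hD⟩ := TreeDecomp.exists_width_le_elimWidth (G := G) e
    exact ⟨n, D, hD.trans he⟩
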